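/- arXiv:1311.4734 — 2 statements merged into one kernel-verified Lean document; each statement's English description precedes it below -/
import Mathlib

section
/- There exists a compact shift-invariant subset X of the full shift Σ_2 containing an infinite set D such that every pair of distinct points of D is extremal distributionally 2-scrambled (Φ* ≡ 1 and Φ(δ) = 0 for all 0 < δ < diam X), yet X contains no Li-Yorke scrambled triple. -/
open Filter

/-- Metric on Σ₂ = {0,1}^ℕ : d(u,v) = Σ_{i≥1} δ(u_i,v_i)/2^i (coordinates 0-indexed). -/
noncomputable def dist2 (u v : ℕ → Bool) : ℝ :=
  ∑' i : ℕ, if u i = v i then 0 else (1/2)^(i+1)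

/-- The shift map. -/
def shift (u : ℕ → Bool) : ℕ → Bool := fun n => u (n + 1)

/-- Binary complement of a word. -/
def wordCompl (B : List Bool) : List Bool := B.map (fun b => !b)

/-- Morse blocks: M_0 = 0, M_{i+1} = M_i followed by its complement. -/
def morseBlock : ℕ → List Bool
  | 0 => [false]
  | i + 1 => morseBlock i ++ wordCompl (morseBlock i)

/-- The Morse sequence, the limit of the Morse blocks. -/
def morse : ℕ → Bool := fun n => (morseBlock (n + 1)).getD n false

open Classical in
/-- Infinite concatenation of a sequence of (nonempty) blocks. -/
noncomputable def concatSeq (B : ℕ → List Bool) (k : ℕ) : Bool :=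
  if h : ∃ n, ∑ i ∈ Finset.range n, (B i).length ≤ k ∧
      k < ∑ i ∈ Finset.range (n + 1), (B i).length then
    (B h.choose).getD (k - ∑ i ∈ Finset.range h.choose, (B i).length) false
  else false

open Classical in
/-- Lower distributional function. -/
noncomputable def Phi (x y : ℕ → Bool) (δ : ℝ) : ℝ :=
  liminf (fun m : ℕ =>
    (((Finset.Ioo 0 m).filter (fun k => dist2 (shift^[k] x) (shift^[k] y) < δ)).card : ℝ) / m)
    atTop

open Classical in
/-- Upper distributional function. -/
noncomputable def PhiStar (x y : ℕ → Bool) (ε : ℝ) : ℝ :=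
  limsup (fun m : ℕ =>
    (((Finset.Ioo 0 m).filter (fun k => dist2 (shift^[k] x) (shift^[k] y) < ε)).card : ℝ) / m)
    atTop

/-- A Li-Yorke scrambled triple. -/
noncomputable def ScrTriple (x y z : ℕ → Bool) : Prop :=
  x ≠ y ∧ x ≠ z ∧ y ≠ z ∧
  liminf (fun k : ℕ => max (max (dist2 (shift^[k] x) (shift^[k] y))
      (dist2 (shift^[k] x) (shift^[k] z))) (dist2 (shift^[k] y) (shift^[k] z))) atTop = 0 ∧
  0 < limsup (fun k : ℕ => min (min (dist2 (shift^[k] x) (shift^[k] y))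
      (dist2 (shift^[k] x) (shift^[k] z))) (dist2 (shift^[k] y) (shift^[k] z))) atTop

/-- Concatenation of Morse blocks M_{a j}, complemented where `e j = true`. -/
noncomputable def blockPt (a : ℕ → ℕ) (e : ℕ → Bool) : ℕ → Bool :=
  concatSeq (fun j => if e j then wordCompl (morseBlock (a j)) else morseBlock (a j))

/-- A point occurring as in Theorem 2: odd-position blocks fixed, even-position blocks chosen by α. -/
noncomputable def xpt (a : ℕ → ℕ) (α : ℕ → Bool) : ℕ → Bool :=
  blockPt a (fun j => if j % 2 = 0 then α (j / 2) else false)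

/-- Cantor set predicate. -/
def IsCantorSet (C : Set (ℕ → Bool)) : Prop :=
  C.Nonempty ∧ IsCompact C ∧ Perfect C ∧ IsTotallyDisconnected C

/-- The Morse minimal set: orbit closure of the Morse sequence. -/
def morseMinimal : Set (ℕ → Bool) := closure {y | ∃ k : ℕ, y = shift^[k] morse}


/-- Diameter of a set with respect to the metric `dist2`. -/
noncomputable def diam2 (X : Set (ℕ → Bool)) : ℝ :=
  sSup {r : ℝ | ∃ u ∈ X, ∃ v ∈ X, r = dist2 u v}

namespace DistScrambled

section Metric

lemma summable_dist2 (u v : ℕ → Bool) :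
    Summable (fun i : ℕ => if u i = v i then (0 : ℝ) else (1/2)^(i+1)) := by
  refine Summable.of_nonneg_of_le (fun i => ?_) (fun i => ?_)
    ((summable_nat_add_iff 1).2 (summable_geometric_two))
  · split_ifs <;> positivity
  · split_ifs
    · positivity
    · exact le_rfl

lemma dist2_nonneg (u v : ℕ → Bool) : 0 ≤ dist2 u v :=
  tsum_nonneg fun i => by split_ifs <;> positivity

lemma tsum_half_pow_succ : ∑' i : ℕ, (1/2 : ℝ)^(i+1) = 1 := by
  simp_rw [pow_succ, tsum_mul_right, tsum_geometric_two]
  norm_num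

lemma dist2_le_of_agree {u v : ℕ → Bool} {L : ℕ} (h : ∀ i < L, u i = v i) :
    dist2 u v ≤ (1/2)^L := by
  have hs := summable_dist2 u v
  have h0 : ∑ i ∈ Finset.range L, (if u i = v i then (0 : ℝ) else (1/2)^(i+1)) = 0 :=
    Finset.sum_eq_zero fun i hi => if_pos (h i (Finset.mem_range.1 hi))
  have hg : Summable fun i : ℕ => (1/2 : ℝ)^L * (1/2)^(i+1) :=
    ((summable_nat_add_iff 1).2 summable_geometric_two).mul_left _
  rw [dist2, ← hs.sum_add_tsum_nat_add L, h0, zero_add]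
  calc _ ≤ ∑' i : ℕ, (1/2 : ℝ)^L * (1/2)^(i+1) := by
        refine Summable.tsum_le_tsum (fun i => ?_) ((summable_nat_add_iff L).2 hs) hg
        split_ifs
        · positivity
        · rw [← pow_add]
          exact le_of_eq (by congr 1; omega)
    _ = (1/2)^L := by rw [tsum_mul_left, tsum_half_pow_succ, mul_one]

lemma dist2_le_one (u v : ℕ → Bool) : dist2 u v ≤ 1 := by
  simpa using dist2_le_of_agree (u := u) (v := v) (L := 0) (by simp)

lemma half_pow_le_dist2 {u v : ℕ → Bool} {i : ℕ} (h : u i ≠ v i) :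
    (1/2)^(i+1) ≤ dist2 u v := by
  have := (summable_dist2 u v).le_tsum i (fun j _ => by split_ifs <;> positivity)
  rwa [if_neg h] at this

lemma agree_of_dist2_lt {u v : ℕ → Bool} {L : ℕ} (h : dist2 u v < (1/2)^L) :
    ∀ i < L, u i = v i := by
  intro i hi
  by_contra hne
  have h1 := half_pow_le_dist2 hne
  have h2 : (1/2 : ℝ)^L ≤ (1/2)^(i+1) :=
    pow_le_pow_of_le_one (by norm_num) (by norm_num) hi
  linarith

lemma dist2_add_dist2_not (u v : ℕ → Bool) : dist2 u v + dist2 u (fun i => !v i) = 1 := by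
  rw [dist2, dist2, ← (summable_dist2 u v).tsum_add (summable_dist2 u _)]
  refine (tsum_congr fun i => ?_).trans tsum_half_pow_succ
  cases u i <;> cases v i <;> simp

lemma le_dist2_of_differ {u v : ℕ → Bool} {L : ℕ} (h : ∀ i < L, u i ≠ v i) :
    1 - (1/2)^L ≤ dist2 u v := by
  have h1 : dist2 u (fun i => !v i) ≤ (1/2)^L :=
    dist2_le_of_agree fun i hi => by
      have := h i hi
      revert this
      cases u i <;> cases v i <;> simp
  have := dist2_add_dist2_not u v
  linarith

lemma diam2_le_one (X : Set (ℕ → Bool)) : diam2 X ≤ 1 :=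
  Real.sSup_le (by rintro r ⟨u, -, v, -, rfl⟩; exact dist2_le_one u v) zero_le_one

lemma shift_iterate_apply (x : ℕ → Bool) (k n : ℕ) : (shift^[k] x) n = x (k + n) := by
  induction k generalizing n with
  | zero => simp
  | succ k ih =>
    rw [Function.iterate_succ_apply', shift, ih]
    congr 1
    omega

end Metric

section Triples

/-- Arbitrarily late, the three sequences coincide on arbitrarily long windows. -/
def Proximal (x y z : ℕ → Bool) : Prop :=
  ∀ L N : ℕ, ∃ k ≥ N, ∀ j < L, x (k + j) = y (k + j) ∧ y (k + j) = z (k + j)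

/-- Arbitrarily late, the three sequences are pairwise distinct on a window of fixed length. -/
def Separated (x y z : ℕ → Bool) : Prop :=
  ∃ L : ℕ, ∀ N : ℕ, ∃ k ≥ N, (∃ j < L, x (k + j) ≠ y (k + j)) ∧
    (∃ j < L, x (k + j) ≠ z (k + j)) ∧ ∃ j < L, y (k + j) ≠ z (k + j)

variable {x y z : ℕ → Bool}

lemma Proximal.rotate (h : Proximal x y z) : Proximal y z x := fun L N =>
  let ⟨k, hk, H⟩ := h L N
  ⟨k, hk, fun j hj => ⟨(H j hj).2, ((H j hj).1.trans (H j hj).2).symm⟩⟩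

lemma Separated.rotate (h : Separated x y z) : Separated y z x := by
  obtain ⟨L, h⟩ := h
  refine ⟨L, fun N => ?_⟩
  obtain ⟨k, hk, ⟨a, ha, ha'⟩, ⟨b, hb, hb'⟩, hc⟩ := h N
  exact ⟨k, hk, hc, ⟨a, ha, ha'.symm⟩, ⟨b, hb, hb'.symm⟩⟩

lemma proximal_of_scrTriple (h : ScrTriple x y z) : Proximal x y z := by
  obtain ⟨-, -, -, h, -⟩ := h
  intro L N
  have hpos : (0 : ℝ) < (1/2)^L := by positivity
  rw [← h] at hpos
  have hf := frequently_lt_of_liminf_lt (IsBoundedUnder.isCoboundedUnder_ge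
    (isBoundedUnder_of ⟨1, fun k => by simp [dist2_le_one]⟩)) hpos
  obtain ⟨k, hk, hlt⟩ := (frequently_atTop.1 hf) N
  simp only [max_lt_iff] at hlt
  refine ⟨k, hk, fun j hj => ?_⟩
  have h1 := agree_of_dist2_lt hlt.1.1 j hj
  have h2 := agree_of_dist2_lt hlt.2 j hj
  simp only [shift_iterate_apply] at h1 h2
  exact ⟨h1, h2⟩

lemma exists_ne_of_lt_dist2 {c : ℝ} {L k : ℕ} (hL : (1/2 : ℝ)^L < c)
    (h : c < dist2 (shift^[k] x) (shift^[k] y)) : ∃ j < L, x (k + j) ≠ y (k + j) := by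
  by_contra! hne
  have := dist2_le_of_agree (u := shift^[k] x) (v := shift^[k] y) (L := L)
    (fun i hi => by simpa only [shift_iterate_apply] using hne i hi)
  linarith

lemma separated_of_scrTriple (h : ScrTriple x y z) : Separated x y z := by
  obtain ⟨-, -, -, -, h⟩ := h
  obtain ⟨c, hc0, hc⟩ := exists_between h
  obtain ⟨L, hL⟩ := exists_pow_lt_of_lt_one hc0 (by norm_num : (1/2 : ℝ) < 1)
  have hf := frequently_lt_of_lt_limsup (IsBoundedUnder.isCoboundedUnder_le
    (isBoundedUnder_of ⟨0, fun k => by simp [dist2_nonneg]⟩)) hc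
  refine ⟨L, fun N => ?_⟩
  obtain ⟨k, hk, hlt⟩ := (frequently_atTop.1 hf) N
  simp only [lt_min_iff] at hlt
  exact ⟨k, hk, exists_ne_of_lt_dist2 hL hlt.1.1, exists_ne_of_lt_dist2 hL hlt.1.2,
    exists_ne_of_lt_dist2 hL hlt.2⟩

end Triples

section Offsets

/-- From index `N` on, the difference sequence of `x` follows the period-doubling pattern
with phase `z`, up to `2`-adic level `m`. -/
def HasOffset (m N z : ℕ) (x : ℕ → Bool) : Prop :=
  ∀ j < m, ∀ n ≥ N, (3 * n + z) % 2 ^ (j + 1) = 2 ^ j → xor (x n) (x (n + 1)) = j.bodd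

lemma exists_mod_eq_of_not_dvd {m a : ℕ} (h : ¬ 2 ^ m ∣ a) :
    ∃ j < m, a % 2 ^ (j + 1) = 2 ^ j := by
  induction m with
  | zero => simp at h
  | succ m ih =>
    by_cases hm : 2 ^ m ∣ a
    · refine ⟨m, by omega, ?_⟩
      obtain ⟨c, rfl⟩ := hm
      rw [pow_succ, Nat.mul_mod_mul_left]
      rcases Nat.mod_two_eq_zero_or_one c with hc | hc
      · exact absurd (by rw [pow_succ]; exact mul_dvd_mul_left _ (Nat.dvd_of_mod_eq_zero hc)) h
      · rw [hc, mul_one]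
    · obtain ⟨j, hj, H⟩ := ih hm
      exact ⟨j, by omega, H⟩

lemma padicValNat_eq_of_mod {a j : ℕ} (h : a % 2 ^ (j + 1) = 2 ^ j) : padicValNat 2 a = j := by
  have ha : a ≠ 0 := by
    rintro rfl
    simp at h
    exact absurd h.symm (by positivity)
  have h1 : 2 ^ j ∣ a := by
    rw [← Nat.div_add_mod a (2 ^ (j + 1)), h]
    exact dvd_add (Dvd.dvd.mul_right (pow_dvd_pow 2 (by omega)) _) dvd_rfl
  have h2 : ¬ 2 ^ (j + 1) ∣ a := by
    intro hd
    rw [Nat.mod_eq_zero_of_dvd hd] at h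
    exact absurd h.symm (by positivity)
  rw [padicValNat_dvd_iff_le ha] at h1 h2
  omega

/-- A window of length `2 ^ m` meets every phase modulo `2 ^ m`. -/
lemma exists_window_mod (m k z t : ℕ) :
    ∃ i < 2 ^ m, (3 * (k + i) + z) ≡ t [MOD 2 ^ m] := by
  have hcop : Nat.Coprime 3 (2 ^ m) := Nat.Coprime.pow_right m (by norm_num)
  obtain ⟨c, hc⟩ : ∃ c, 3 * c ≡ 1 [MOD 2 ^ m] := by
    rcases Nat.eq_zero_or_pos m with rfl | hm
    · exact ⟨0, by simp [Nat.modEq_one]⟩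
    · obtain ⟨c, hc⟩ := Nat.exists_mul_mod_eq_one_of_coprime hcop (Nat.one_lt_two_pow (by omega))
      exact ⟨c, by rw [Nat.ModEq, hc.2, Nat.mod_eq_of_lt (Nat.one_lt_two_pow (by omega))]⟩
  have hp : 0 < 2 ^ m := by positivity
  generalize 2 ^ m = q at *
  obtain ⟨s, hs⟩ : ∃ s, s + (3 * k + z) ≡ t [MOD q] := by
    refine ⟨t + (3 * k + z) * (q - 1), ?_⟩
    have : t + (3 * k + z) * (q - 1) + (3 * k + z) = t + q * (3 * k + z) := by
      obtain ⟨r, rfl⟩ : ∃ r, q = r + 1 := ⟨q - 1, by omega⟩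
      simp
      ring
    rw [this]
    simp [Nat.ModEq]
  refine ⟨(c * s) % q, Nat.mod_lt _ hp, ?_⟩
  have h1 : 3 * ((c * s) % q) ≡ s [MOD q] := by
    have : 3 * ((c * s) % q) ≡ 3 * (c * s) [MOD q] := (Nat.mod_modEq _ _).mul_left 3
    refine this.trans ?_
    rw [← mul_assoc]
    simpa using hc.mul_right s
  have : 3 * (k + (c * s) % q) + z = 3 * ((c * s) % q) + (3 * k + z) := by ring
  rw [this]
  exact (h1.add_right _).trans hs

/-- Sequences that coincide on a long window have the same phase. -/
lemma modEq_of_agree {m N N' z z' k : ℕ} {x x' : ℕ → Bool} (hx : HasOffset (m + 1) N z x)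
    (hx' : HasOffset (m + 1) N' z' x') (hN : N ≤ k) (hN' : N' ≤ k)
    (hag : ∀ j < 2 ^ (m + 1) + 1, x (k + j) = x' (k + j)) : z ≡ z' [MOD 2 ^ m] := by
  by_contra hne
  wlog hle : z ≤ z' generalizing z z' N N' x x'
  · exact this hx' hx hN' hN (fun j hj => (hag j hj).symm) (fun h => hne h.symm) (by omega)
  obtain ⟨d, rfl⟩ := Nat.exists_eq_add_of_le hle
  have hd : ¬ 2 ^ m ∣ d := by
    intro hd
    apply hne
    rw [Nat.ModEq.comm]
    simpa using (Nat.modEq_zero_iff_dvd.2 hd).add_left z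
  obtain ⟨j, hj, hdj⟩ := exists_mod_eq_of_not_dvd hd
  obtain ⟨i, hi, him⟩ := exists_window_mod (j + 2) k z (2 ^ (j + 1))
  have hi' : i < 2 ^ (m + 1) :=
    hi.trans_le (Nat.pow_le_pow_right (by norm_num) (by omega))
  have e1 : (3 * (k + i) + z) % 2 ^ (j + 2) = 2 ^ (j + 1) := by
    rw [him]
    exact Nat.mod_eq_of_lt (Nat.pow_lt_pow_right (by norm_num) (by omega))
  have e2 : (3 * (k + i) + (z + d)) % 2 ^ (j + 1) = 2 ^ j := by
    have h0 : 3 * (k + i) + z ≡ 0 [MOD 2 ^ (j + 1)] := by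
      have := him.of_dvd (pow_dvd_pow 2 (by omega : j + 1 ≤ j + 2))
      exact this.trans (by simp [Nat.ModEq])
    have := h0.add_right d
    rw [zero_add, add_assoc] at this
    exact Eq.trans this hdj
  have h1 := hx (j + 1) (by omega) (k + i) (by omega) e1
  have h2 := hx' j (by omega) (k + i) (by omega) e2
  rw [hag i (by omega), show k + i + 1 = k + (i + 1) by omega, hag (i + 1) (by omega)] at h1
  rw [show k + i + 1 = k + (i + 1) by omega, h1, Nat.bodd_succ] at h2
  simp at h2

/-- The sequences whose difference sequence is a period-doubling Toeplitz sequence. -/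
def toeplitzSet : Set (ℕ → Bool) := {x | ∀ m, ∃ z < 2 ^ m, HasOffset m 0 z x}

lemma isClosed_exists_hasOffset (m : ℕ) :
    IsClosed {x : ℕ → Bool | ∃ z < 2 ^ m, HasOffset m 0 z x} := by
  have : {x : ℕ → Bool | ∃ z < 2 ^ m, HasOffset m 0 z x} =
      ⋃ z ∈ Set.Iio (2 ^ m), {x | HasOffset m 0 z x} := by
    ext
    simp
  rw [this]
  refine (Set.finite_Iio _).isClosed_biUnion fun z _ => ?_
  simp only [HasOffset, Set.ofPred_forall]
  refine isClosed_iInter fun j => isClosed_iInter fun _ => isClosed_iInter fun n =>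
    isClosed_iInter fun _ => isClosed_iInter fun _ => ?_
  have hc : Continuous fun x : ℕ → Bool => xor (x n) (x (n + 1)) := by
    have h2 : Continuous fun p : Bool × Bool => xor p.1 p.2 := continuous_of_discreteTopology
    exact h2.comp (by fun_prop : Continuous fun x : ℕ → Bool => (x n, x (n + 1)))
  exact isClosed_eq hc continuous_const

lemma HasOffset.mod {m N z : ℕ} {x : ℕ → Bool} (h : HasOffset m N z x) :
    HasOffset m N (z % 2 ^ m) x := by
  intro j hj n hn hmod
  refine h j hj n hn ?_
  rw [← hmod]
  have : z ≡ z % 2 ^ m [MOD 2 ^ (j + 1)] :=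
    ((Nat.mod_modEq z (2 ^ m)).of_dvd (pow_dvd_pow 2 hj)).symm
  exact this.add_left _

lemma HasOffset.shift_iterate {m N z : ℕ} {x : ℕ → Bool} (h : HasOffset m N z x) (i : ℕ) :
    HasOffset m (N - i) (z + 3 * i) (shift^[i] x) := by
  intro j hj n hn hmod
  rw [shift_iterate_apply, shift_iterate_apply, ← add_assoc]
  refine h j hj (i + n) (by omega) ?_
  rw [← hmod]
  congr 1
  ring

lemma shift_mem_toeplitzSet {x : ℕ → Bool} (hx : x ∈ toeplitzSet) : shift x ∈ toeplitzSet := by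
  intro m
  obtain ⟨z, -, hz⟩ := hx m
  have := (hz.shift_iterate 1).mod
  exact ⟨_, Nat.mod_lt _ (by positivity), this⟩

/-- Eventually equal difference sequences together with late agreement force eventual equality. -/
lemma eventually_eq_of_xor_eq {x y : ℕ → Bool} {N k : ℕ}
    (h : ∀ n ≥ N, xor (x n) (x (n + 1)) = xor (y n) (y (n + 1))) (hk : N ≤ k)
    (hxy : x k = y k) : ∀ n ≥ k, x n = y n := by
  intro n hn
  induction n, hn using Nat.le_induction with
  | base => exact hxy
  | succ n hn ih =>
    have := h n (by omega)
    rw [ih] at this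
    exact Bool.xor_right_inj.1 this

lemma not_separated_of_toeplitz {x y z : ℕ → Bool} (hx : x ∈ toeplitzSet) (hy : y ∈ toeplitzSet)
    (hp : Proximal x y z) : ¬ Separated x y z := by
  choose zx _ hzx using hx
  choose zy _ hzy using hy
  have hmod : ∀ m, zx (m + 1) ≡ zy (m + 1) [MOD 2 ^ m] := fun m => by
    obtain ⟨k, -, H⟩ := hp (2 ^ (m + 1) + 1) 0
    exact modEq_of_agree (hzx _) (hzy _) (Nat.zero_le k) (Nat.zero_le k) fun j hj => (H j hj).1
  have hdvd : ∀ n, xor (x n) (x (n + 1)) ≠ xor (y n) (y (n + 1)) →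
      ∀ m, 2 ^ m ∣ 3 * n + zx (m + 1) := by
    intro n hn m
    by_contra hnd
    obtain ⟨j, hj, H⟩ := exists_mod_eq_of_not_dvd hnd
    apply hn
    rw [hzx _ j (by omega) n (Nat.zero_le n) H, hzy (m + 1) j (by omega) n (Nat.zero_le n)]
    rw [← H]
    exact (((hmod m).of_dvd (pow_dvd_pow 2 hj)).add_left _).symm
  obtain ⟨N, hN⟩ : ∃ N, ∀ n ≥ N, xor (x n) (x (n + 1)) = xor (y n) (y (n + 1)) := by
    by_cases hex : ∃ n, xor (x n) (x (n + 1)) ≠ xor (y n) (y (n + 1))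
    · obtain ⟨n₀, h₀⟩ := hex
      refine ⟨n₀ + 1, fun n hn => ?_⟩
      by_contra hne
      obtain ⟨d, rfl⟩ := Nat.exists_eq_add_of_le hn
      set m := 3 * (1 + d)
      have h1 := hdvd _ h₀ m
      have h2 := hdvd _ hne m
      rw [show 3 * (n₀ + 1 + d) + zx (m + 1) = m + (3 * n₀ + zx (m + 1)) by ring] at h2
      have h3 := Nat.le_of_dvd (by omega) ((Nat.dvd_add_left h1).1 h2)
      exact absurd h3 (by simpa using Nat.lt_two_pow_self (n := m))
    · push Not at hex
      exact ⟨0, fun n _ => hex n⟩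
  obtain ⟨k, hk, H⟩ := hp 1 N
  have hxy := eventually_eq_of_xor_eq hN hk (by simpa using (H 0 one_pos).1)
  rintro ⟨L, hS⟩
  obtain ⟨k', hk', ⟨j, -, hj⟩, -⟩ := hS k
  exact hj (hxy _ (by omega))

end Offsets

section Blocks

/-- The left endpoint of the `r`-th block. -/
def border (r : ℕ) : ℕ := (4 ^ r ^ 2 - 1) / 3

lemma three_mul_border_add_one (r : ℕ) : 3 * border r + 1 = 4 ^ r ^ 2 := by
  have h : 4 ^ r ^ 2 % 3 = 1 := by simp [Nat.pow_mod]
  rw [border]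
  generalize 4 ^ r ^ 2 = A at *
  omega

lemma border_zero : border 0 = 0 := by simp [border]

lemma strictMono_border : StrictMono border := by
  intro r s h
  have h1 : 4 ^ r ^ 2 < 4 ^ s ^ 2 :=
    Nat.pow_lt_pow_right (by norm_num) (Nat.pow_lt_pow_left h two_ne_zero)
  have := three_mul_border_add_one r
  have := three_mul_border_add_one s
  omega

lemma mul_border_add_le (r : ℕ) : r * (border r + r) ≤ border (r + 1) := by
  have h0 := three_mul_border_add_one r
  have h1 := three_mul_border_add_one (r + 1)
  have hA : 4 ^ (r + 1) ^ 2 = 4 ^ r ^ 2 * (4 ^ r * 4 ^ r * 4) := by ring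
  have hB : r + 1 ≤ 4 ^ r := Nat.lt_pow_self (by norm_num)
  rw [hA, ← h0] at h1
  have h2 : (3 * border r + 1) * ((r + 1) * (r + 1) * 4) ≤
      (3 * border r + 1) * (4 ^ r * 4 ^ r * 4) := by gcongr
  rw [← h1] at h2
  nlinarith [Nat.zero_le (border r * r ^ 2), Nat.zero_le (border r * r)]

/-- The index of the block containing `n`. -/
def blockIdx (n : ℕ) : ℕ := Nat.findGreatest (fun r => border r ≤ n) n

lemma border_blockIdx_le (n : ℕ) : border (blockIdx n) ≤ n :=
  Nat.findGreatest_spec (P := fun r => border r ≤ n) (Nat.zero_le n) (by simp [border_zero])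

lemma lt_border_blockIdx_succ (n : ℕ) : n < border (blockIdx n + 1) := by
  by_contra! h
  have h1 : blockIdx n + 1 ≤ n := (strictMono_border.le_apply).trans h
  have := Nat.le_findGreatest (P := fun r => border r ≤ n) h1 h
  exact absurd this (by simp [blockIdx])

lemma blockIdx_eq {n r : ℕ} (h : border r ≤ n) (h' : n < border (r + 1)) : blockIdx n = r := by
  have h1 := strictMono_border.lt_iff_lt.1 ((border_blockIdx_le n).trans_lt h')
  have h2 := strictMono_border.lt_iff_lt.1 (h.trans_lt (lt_border_blockIdx_succ n))
  omega

lemma blockIdx_border (r : ℕ) : blockIdx (border r) = r :=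
  blockIdx_eq le_rfl (strictMono_border r.lt_succ_self)

lemma monotone_blockIdx : Monotone blockIdx := fun a b hab => by
  have := strictMono_border.lt_iff_lt.1
    ((border_blockIdx_le a).trans_lt (hab.trans_lt (lt_border_blockIdx_succ b)))
  omega

/-- The reference sequence, with difference sequence `n ↦ v₂(3n + 4) mod 2`. -/
def base : ℕ → Bool
  | 0 => false
  | n + 1 => xor (base n) (padicValNat 2 (3 * n + 4)).bodd

/-- The reference sequence, complemented on the blocks selected by `e`. -/
def pt (e : ℕ → Bool) : ℕ → Bool := fun n => xor (base n) (e (blockIdx n))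

lemma continuous_pt : Continuous pt := by
  refine continuous_pi fun n => ?_
  have h2 : Continuous fun b : Bool => xor (base n) b := continuous_of_discreteTopology
  exact h2.comp (continuous_apply (blockIdx n))

lemma pt_eq_pt_iff (e e' : ℕ → Bool) (n : ℕ) :
    pt e n = pt e' n ↔ e (blockIdx n) = e' (blockIdx n) := by
  simp [pt]

lemma pt_injective : Function.Injective pt := fun e e' h => by
  ext r
  rw [← blockIdx_border r, (pt_eq_pt_iff e e' (border r)).1 (congrFun h _)]

lemma hasOffset_pt (e : ℕ → Bool) (m : ℕ) : HasOffset m (border m) 4 (pt e) := by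
  intro j hj n hn hmod
  have hb : blockIdx (n + 1) = blockIdx n := by
    by_contra hne
    have hlt : blockIdx n < blockIdx (n + 1) :=
      lt_of_le_of_ne (monotone_blockIdx n.le_succ) (Ne.symm hne)
    have h1 : n + 1 = border (blockIdx (n + 1)) := by
      refine le_antisymm ?_ (border_blockIdx_le _)
      exact (lt_border_blockIdx_succ n).trans_le (strictMono_border.monotone hlt)
    set r := blockIdx (n + 1)
    have hmr : m < r := strictMono_border.lt_iff_lt.1 (by omega)
    have h2 : 3 * n + 4 = 4 ^ r ^ 2 := by
      rw [← three_mul_border_add_one, ← h1]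
      ring
    have h3 : 2 ^ (j + 1) ∣ 3 * n + 4 := by
      rw [h2, show 4 = 2 ^ 2 from rfl, ← pow_mul]
      exact pow_dvd_pow 2 (by nlinarith)
    rw [Nat.mod_eq_zero_of_dvd h3] at hmod
    exact absurd hmod.symm (by positivity)
  simp only [pt, hb, base, padicValNat_eq_of_mod hmod]
  cases base n <;> cases e (blockIdx n) <;> simp

end Blocks

section Distribution

variable {x y : ℕ → Bool}

lemma exists_block_ratio {p : ℕ → Prop} (h : ∃ᶠ r in atTop, p r) (L N : ℕ) {η : ℝ} (hη : 0 < η) :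
    ∃ r, p r ∧ N ≤ border (r + 1) ∧ 0 < border (r + 1) ∧
      ((border r + L : ℕ) : ℝ) ≤ η * border (r + 1) := by
  obtain ⟨R, hR⟩ := exists_nat_gt (1 / η)
  obtain ⟨r, hr, hp⟩ := (frequently_atTop.1 h) (max (max L N) (R + 1))
  simp only [max_le_iff] at hr
  have hle : r + 1 ≤ border (r + 1) := strictMono_border.le_apply
  refine ⟨r, hp, by omega, by omega, ?_⟩
  have h1 : (r : ℝ) * (border r + r) ≤ border (r + 1) := by exact_mod_cast mul_border_add_le r
  have h2 : (R : ℝ) ≤ r := by exact_mod_cast (by omega : R ≤ r)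
  have h3 : (L : ℝ) ≤ r := by exact_mod_cast hr.1.1
  have h4 : 1 ≤ η * r := by
    rw [div_lt_iff₀ hη] at hR
    nlinarith
  push_cast
  have h5 : (0 : ℝ) ≤ border r + r := by positivity
  nlinarith

open Classical in
lemma card_ratio_mem (q : ℕ → Prop) (m : ℕ) :
    0 ≤ (((Finset.Ioo 0 m).filter q).card : ℝ) / m ∧
      (((Finset.Ioo 0 m).filter q).card : ℝ) / m ≤ 1 := by
  refine ⟨by positivity, div_le_one_of_le₀ ?_ (by positivity)⟩
  have : ((Finset.Ioo 0 m).filter q).card ≤ m := by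
    refine (Finset.card_filter_le _ _).trans ?_
    simp
  exact_mod_cast this

lemma phiStar_eq_one
    (h : ∃ᶠ r in atTop, ∀ n, border r ≤ n → n < border (r + 1) → x n = y n)
    {ε : ℝ} (hε : 0 < ε) : PhiStar x y ε = 1 := by
  classical
  obtain ⟨L, hL⟩ := exists_pow_lt_of_lt_one hε (by norm_num : (1/2 : ℝ) < 1)
  have hbd := fun m => card_ratio_mem (fun k => dist2 (shift^[k] x) (shift^[k] y) < ε) m
  refine le_antisymm ?_ (le_of_forall_pos_sub_le fun η hη => ?_)
  · refine limsup_le_of_le (IsBoundedUnder.isCoboundedUnder_le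
      (isBoundedUnder_of ⟨0, fun m => (hbd m).1⟩)) (Eventually.of_forall fun m => (hbd m).2)
  · refine le_limsup_of_frequently_le (frequently_atTop.2 fun N => ?_)
      (isBoundedUnder_of ⟨1, fun m => (hbd m).2⟩)
    obtain ⟨r, hr, hN, hpos, hle⟩ := exists_block_ratio h (L + 1) N hη
    refine ⟨border (r + 1), hN, ?_⟩
    set M := border (r + 1)
    have hsub : Finset.Ioo (border r) (M - L) ⊆
        (Finset.Ioo 0 M).filter (fun k => dist2 (shift^[k] x) (shift^[k] y) < ε) := by
      intro k hk
      rw [Finset.mem_Ioo] at hk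
      rw [Finset.mem_filter, Finset.mem_Ioo]
      refine ⟨by omega, (dist2_le_of_agree fun i hi => ?_).trans_lt hL⟩
      rw [shift_iterate_apply, shift_iterate_apply]
      exact hr _ (by omega) (by omega)
    have hcard := Finset.card_le_card hsub
    rw [Nat.card_Ioo] at hcard
    rw [le_div_iff₀ (by exact_mod_cast hpos)]
    have h1 : (M : ℝ) ≤
        ((Finset.Ioo 0 M).filter (fun k => dist2 (shift^[k] x) (shift^[k] y) < ε)).card +
          ((border r + (L + 1) : ℕ) : ℝ) := by
      exact_mod_cast (by omega)
    linarith

lemma phi_eq_zero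
    (h : ∃ᶠ r in atTop, ∀ n, border r ≤ n → n < border (r + 1) → x n ≠ y n)
    {δ : ℝ} (hδ : δ < 1) : Phi x y δ = 0 := by
  classical
  obtain ⟨L, hL⟩ := exists_pow_lt_of_lt_one (sub_pos.2 hδ) (by norm_num : (1/2 : ℝ) < 1)
  have hbd := fun m => card_ratio_mem (fun k => dist2 (shift^[k] x) (shift^[k] y) < δ) m
  refine le_antisymm (le_of_forall_pos_le_add fun η hη => ?_) ?_
  · refine liminf_le_of_frequently_le (frequently_atTop.2 fun N => ?_)
      (isBoundedUnder_of ⟨0, fun m => (hbd m).1⟩)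
    obtain ⟨r, hr, hN, hpos, hle⟩ := exists_block_ratio h L N hη
    refine ⟨border (r + 1), hN, ?_⟩
    set M := border (r + 1)
    have hsub : (Finset.Ioo 0 M).filter (fun k => dist2 (shift^[k] x) (shift^[k] y) < δ) ⊆
        Finset.range (border r) ∪ Finset.Ico (M - L) M := by
      intro k hk
      rw [Finset.mem_filter, Finset.mem_Ioo] at hk
      rw [Finset.mem_union, Finset.mem_range, Finset.mem_Ico]
      by_contra hcon
      have hd : 1 - (1/2 : ℝ)^L ≤ dist2 (shift^[k] x) (shift^[k] y) :=
        le_dist2_of_differ fun i hi => by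
          rw [shift_iterate_apply, shift_iterate_apply]
          exact hr _ (by omega) (by omega)
      linarith [hk.2]
    have hcard := (Finset.card_le_card hsub).trans (Finset.card_union_le _ _)
    rw [Finset.card_range, Nat.card_Ico] at hcard
    rw [div_le_iff₀ (by exact_mod_cast hpos), zero_add]
    refine le_trans ?_ hle
    exact_mod_cast (by omega)
  · refine le_liminf_of_le (IsBoundedUnder.isCoboundedUnder_ge
      (isBoundedUnder_of ⟨1, fun m => (hbd m).2⟩)) (Eventually.of_forall fun m => (hbd m).1)

end Distribution

section Selectors

/-- A label on block indices taking every value infinitely often on the even indices. -/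
def label (r : ℕ) : ℕ := (Nat.unpair (r / 2)).1

/-- Selectors: zero, and the indicators of the label classes on the even indices. -/
def selectors : Set (ℕ → Bool) :=
  {e | (∀ r, r % 2 = 1 → e r = false) ∧
    (∀ r s, r % 2 = 0 → s % 2 = 0 → label r = label s → e r = e s) ∧
    ∀ r s, label r ≠ label s → e r = false ∨ e s = false}

variable {e e' : ℕ → Bool}

lemma isClosed_selectors : IsClosed selectors := by
  simp only [selectors, Set.ofPred_and, Set.ofPred_forall, Set.ofPred_or]
  refine IsClosed.inter ?_ (IsClosed.inter ?_ ?_)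
  · exact isClosed_iInter fun r => isClosed_iInter fun _ =>
      isClosed_eq (continuous_apply r) continuous_const
  · exact isClosed_iInter fun r => isClosed_iInter fun s => isClosed_iInter fun _ =>
      isClosed_iInter fun _ => isClosed_iInter fun _ =>
      isClosed_eq (continuous_apply r) (continuous_apply s)
  · exact isClosed_iInter fun r => isClosed_iInter fun s => isClosed_iInter fun _ =>
      (isClosed_eq (continuous_apply r) continuous_const).union
        (isClosed_eq (continuous_apply s) continuous_const)

lemma eq_of_true (he : e ∈ selectors) (he' : e' ∈ selectors) {r : ℕ} (h : e r = true)
    (h' : e' r = true) : e = e' := by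
  have key : ∀ f ∈ selectors, f r = true → ∀ s, f s = decide (s % 2 = 0 ∧ label s = label r) := by
    intro f hf hr s
    have hr2 : r % 2 = 0 := by
      by_contra hne
      simp [hf.1 r (by omega)] at hr
    by_cases hs : s % 2 = 0
    · by_cases hl : label s = label r
      · simp [hs, hl, hf.2.1 s r hs hr2 hl, hr]
      · simpa [hs, hl, hr] using hf.2.2 s r hl
    · simp [hs, hf.1 s (by omega)]
  ext s
  rw [key e he h, key e' he' h']

lemma zero_mem_selectors : (fun _ => false) ∈ selectors := by simp [selectors]

/-- The indicator of the `i`-th label class on the even indices. -/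
def selector (i : ℕ) : ℕ → Bool := fun r => decide (r % 2 = 0 ∧ label r = i)

lemma selector_mem (i : ℕ) : selector i ∈ selectors := by
  refine ⟨fun r hr => by simp [selector, hr], fun r s hr hs h => by simp [selector, hr, hs, h],
    fun r s h => ?_⟩
  simp only [selector, decide_eq_false_iff_not]
  by_contra! hcon
  exact h (hcon.1.2.trans hcon.2.2.symm)

lemma label_two_mul_pair (i k : ℕ) : label (2 * Nat.pair i k) = i := by
  simp [label]

lemma selector_injective : Function.Injective selector := fun i j h => by
  have := congrFun h (2 * Nat.pair i 0)
  simpa [selector, label_two_mul_pair] using this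

lemma frequently_eq (he : e ∈ selectors) (he' : e' ∈ selectors) :
    ∃ᶠ r in atTop, e r = e' r :=
  frequently_atTop.2 fun N => ⟨2 * N + 1, by omega, by
    rw [he.1 _ (by omega), he'.1 _ (by omega)]⟩

lemma frequently_ne (he : e ∈ selectors) (he' : e' ∈ selectors) (hne : e ≠ e') :
    ∃ᶠ r in atTop, e r ≠ e' r := by
  obtain ⟨r, hr⟩ := Function.ne_iff.1 hne
  have hr2 : r % 2 = 0 := by
    by_contra h
    exact hr (by rw [he.1 _ (by omega), he'.1 _ (by omega)])
  refine frequently_atTop.2 fun N => ⟨2 * Nat.pair (label r) N, ?_, ?_⟩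
  · have := Nat.right_le_pair (label r) N
    omega
  · rwa [he.2.1 _ r (by omega) hr2 (label_two_mul_pair _ _),
      he'.2.1 _ r (by omega) hr2 (label_two_mul_pair _ _)]

end Selectors

section Subshift

/-- The subshift: Toeplitz part together with the orbits of the selected points. -/
def subshift : Set (ℕ → Bool) :=
  toeplitzSet ∪ {x | ∃ i, ∃ e ∈ selectors, x = shift^[i] (pt e)}

variable {x y z e e' e'' : ℕ → Bool}

lemma continuous_shift : Continuous shift :=
  continuous_pi fun n => continuous_apply (n + 1)

lemma isCompact_subshift : IsCompact subshift := by
  refine IsClosed.isCompact ?_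
  have hEq : subshift = ⋂ m, ({x | ∃ z < 2 ^ m, HasOffset m 0 z x} ∪
      ⋃ i ∈ Set.Iio (border m), (fun e => shift^[i] (pt e)) '' selectors) := by
    ext x
    simp only [Set.mem_iInter, Set.mem_union, Set.mem_iUnion, Set.mem_image, Set.mem_Iio]
    constructor
    · rintro (hx | ⟨i, e, he, rfl⟩) m
      · exact Or.inl (hx m)
      · rcases lt_or_ge i (border m) with hi | hi
        · exact Or.inr ⟨i, hi, e, he, rfl⟩
        · have := ((hasOffset_pt e m).shift_iterate i).mod
          rw [Nat.sub_eq_zero_of_le hi] at this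
          exact Or.inl ⟨_, Nat.mod_lt _ (by positivity), this⟩
    · intro h
      by_cases hT : x ∈ toeplitzSet
      · exact Or.inl hT
      · obtain ⟨m, hm⟩ : ∃ m, ¬ ∃ z < 2 ^ m, HasOffset m 0 z x := by
          by_contra! hcon
          exact hT hcon
        obtain ⟨i, -, e, he, rfl⟩ := (h m).resolve_left hm
        exact Or.inr ⟨i, e, he, rfl⟩
  rw [hEq]
  refine isClosed_iInter fun m => (isClosed_exists_hasOffset m).union
    ((Set.finite_Iio _).isClosed_biUnion fun i _ => ?_)
  exact (isClosed_selectors.isCompact.image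
    ((continuous_shift.iterate i).comp continuous_pt)).isClosed

lemma shift_mem_subshift (hx : x ∈ subshift) : shift x ∈ subshift := by
  rcases hx with hx | ⟨i, e, he, rfl⟩
  · exact Or.inl (shift_mem_toeplitzSet hx)
  · exact Or.inr ⟨i + 1, e, he, (Function.iterate_succ_apply' _ _ _).symm⟩

lemma eq_of_forall_modEq {a b : ℕ} (h : ∀ m, a ≡ b [MOD 2 ^ m]) : a = b := by
  have ha : a < 2 ^ (a + b) :=
    (Nat.lt_two_pow_self).trans_le (Nat.pow_le_pow_right (by norm_num) (by omega))
  have hb : b < 2 ^ (a + b) :=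
    (Nat.lt_two_pow_self).trans_le (Nat.pow_le_pow_right (by norm_num) (by omega))
  exact (h (a + b)).eq_of_lt_of_lt ha hb

/-- Agreement on arbitrarily long windows forces equal orbit times. -/
lemma Proximal.time_eq {i i' : ℕ}
    (h : Proximal (shift^[i] (pt e)) (shift^[i'] (pt e')) z) : i = i' := by
  have := eq_of_forall_modEq (a := 4 + 3 * i) (b := 4 + 3 * i') fun m => by
    obtain ⟨k, hk, H⟩ := h (2 ^ (m + 1) + 1) (border (m + 1))
    exact modEq_of_agree ((hasOffset_pt e (m + 1)).shift_iterate i)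
      ((hasOffset_pt e' (m + 1)).shift_iterate i') (by omega) (by omega)
      fun j hj => (H j hj).1
  omega

/-- A Toeplitz point with the phase of an orbit point follows the reference sequence
up to complementation. -/
lemma exists_eq_of_toeplitz {i : ℕ} (hz : z ∈ toeplitzSet)
    (h : Proximal (shift^[i] (pt e)) y z) : ∃ c, z = shift^[i] (pt fun _ => c) := by
  have hx : ∀ n, xor (z n) (z (n + 1)) = xor (base (i + n)) (base (i + n + 1)) := by
    intro n
    have hnd : ¬ 2 ^ (3 * (i + n) + 4) ∣ 3 * (i + n) + 4 := fun hd =>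
      absurd (Nat.le_of_dvd (by omega) hd) (by simpa using Nat.lt_two_pow_self)
    obtain ⟨j, hj, hmod⟩ := exists_mod_eq_of_not_dvd hnd
    obtain ⟨t, -, ht⟩ := hz (j + 2)
    obtain ⟨k, hk, H⟩ := h (2 ^ (j + 2) + 1) (border (j + 2))
    have hmodEq : 4 + 3 * i ≡ t [MOD 2 ^ (j + 1)] :=
      modEq_of_agree ((hasOffset_pt e (j + 2)).shift_iterate i) ht (by omega) (Nat.zero_le k)
        fun l hl => (H l hl).1.trans (H l hl).2
    rw [ht j (by omega) n (Nat.zero_le n), base, padicValNat_eq_of_mod hmod]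
    · simp
    · rw [← hmod, show 3 * (i + n) + 4 = 3 * n + (4 + 3 * i) by ring]
      exact (hmodEq.add_left _).symm
  refine ⟨xor (z 0) (base i), ?_⟩
  ext n
  rw [shift_iterate_apply, pt]
  induction n with
  | zero => cases z 0 <;> cases base i <;> simp
  | succ n ih =>
    have := hx n
    rw [ih] at this
    rw [← add_assoc]
    revert this
    cases z 0 <;> cases base i <;> cases base (i + n) <;> cases base (i + n + 1) <;>
      cases z (n + 1) <;> simp

lemma not_separated_of_selectors (he : e ∈ selectors) (he' : e' ∈ selectors)
    (he'' : e'' ∈ selectors) (i : ℕ) :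
    ¬ Separated (shift^[i] (pt e)) (shift^[i] (pt e')) (shift^[i] (pt e'')) := by
  rintro ⟨L, h⟩
  obtain ⟨k, hk, ⟨a, ha, ha'⟩, ⟨b, hb, hb'⟩, ⟨c, hc, hc'⟩⟩ := h (border (L + 1))
  simp only [shift_iterate_apply, ne_eq, pt_eq_pt_iff] at ha' hb' hc'
  set r := blockIdx (i + k)
  have hrL : L + 1 ≤ r := by
    have := monotone_blockIdx (show border (L + 1) ≤ i + k by omega)
    rwa [blockIdx_border] at this
  have hwin : ∀ j < L, blockIdx (i + (k + j)) = r ∨ blockIdx (i + (k + j)) = r + 1 := by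
    intro j hj
    have h1 : r ≤ blockIdx (i + (k + j)) := monotone_blockIdx (by omega)
    have h2 : i + (k + j) < border (r + 2) := by
      have h3 : i + k < border (r + 1) := lt_border_blockIdx_succ _
      have h4 := mul_border_add_le (r + 1)
      have h5 : r + 1 + 1 = r + 2 := rfl
      rw [h5] at h4
      nlinarith
    have h6 := strictMono_border.lt_iff_lt.1 ((border_blockIdx_le _).trans_lt h2)
    omega
  obtain ⟨q, hq⟩ : ∃ q, ∀ j < L, ∀ f ∈ selectors, ∀ g ∈ selectors,
      f (blockIdx (i + (k + j))) ≠ g (blockIdx (i + (k + j))) → blockIdx (i + (k + j)) = q := by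
    rcases Nat.mod_two_eq_zero_or_one r with hr | hr
    · refine ⟨r, fun j hj f hf g hg hfg => (hwin j hj).resolve_right fun h => hfg ?_⟩
      rw [hf.1 _ (by omega), hg.1 _ (by omega)]
    · refine ⟨r + 1, fun j hj f hf g hg hfg => (hwin j hj).resolve_left fun h => hfg ?_⟩
      rw [hf.1 _ (by omega), hg.1 _ (by omega)]
  rw [hq a ha e he e' he' ha'] at ha'
  rw [hq b hb e he e'' he'' hb'] at hb'
  rw [hq c hc e' he' e'' he'' hc'] at hc'
  revert ha' hb' hc'
  cases e q <;> cases e' q <;> cases e'' q <;> simp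

lemma not_separated_of_orbit {i i' : ℕ} (he : e ∈ selectors) (he' : e' ∈ selectors)
    (hne : shift^[i] (pt e) ≠ shift^[i'] (pt e')) (hz : z ∈ subshift)
    (hp : Proximal (shift^[i] (pt e)) (shift^[i'] (pt e')) z) :
    ¬ Separated (shift^[i] (pt e)) (shift^[i'] (pt e')) z := by
  obtain rfl := hp.time_eq
  rcases hz with hz | ⟨i'', e'', he'', rfl⟩
  · obtain ⟨c, rfl⟩ := exists_eq_of_toeplitz hz hp
    cases c
    · exact not_separated_of_selectors he he' zero_mem_selectors i
    · obtain ⟨k, -, H⟩ := hp 1 0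
      obtain ⟨h1, h2⟩ := H 0 one_pos
      simp only [shift_iterate_apply, pt_eq_pt_iff] at h1 h2
      exact absurd (by rw [eq_of_true he he' (h1.trans h2) h2]) hne
  · obtain rfl := hp.rotate.time_eq
    exact not_separated_of_selectors he he' he'' i

lemma not_scrTriple (hx : x ∈ subshift) (hy : y ∈ subshift) (hz : z ∈ subshift) :
    ¬ ScrTriple x y z := by
  intro h
  have hp := proximal_of_scrTriple h
  have hs := separated_of_scrTriple h
  obtain ⟨hxy, hxz, hyz, -⟩ := h
  rcases id hx with hx' | ⟨i, e, he, rfl⟩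
  · rcases id hy with hy' | ⟨i', e', he', rfl⟩
    · exact not_separated_of_toeplitz hx' hy' hp hs
    · rcases id hz with hz' | ⟨i'', e'', he'', rfl⟩
      · exact not_separated_of_toeplitz hz' hx' hp.rotate.rotate hs.rotate.rotate
      · exact not_separated_of_orbit he' he'' hyz hx hp.rotate hs.rotate
  · rcases id hy with hy' | ⟨i', e', he', rfl⟩
    · rcases id hz with hz' | ⟨i'', e'', he'', rfl⟩
      · exact not_separated_of_toeplitz hy' hz' hp.rotate hs.rotate
      · exact not_separated_of_orbit he'' he hxz.symm hy hp.rotate.rotate hs.rotate.rotate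
    · exact not_separated_of_orbit he he' hxy hz hp hs

end Subshift

end DistScrambled

theorem stmt17 : ∃ X : Set (ℕ → Bool), IsCompact X ∧ (∀ x ∈ X, shift x ∈ X) ∧
    ∃ D : Set (ℕ → Bool), D ⊆ X ∧ D.Infinite ∧
    (∀ x ∈ D, ∀ y ∈ D, x ≠ y →
      (∀ ε > 0, PhiStar x y ε = 1) ∧ (∀ δ : ℝ, 0 < δ → δ < diam2 X → Phi x y δ = 0)) ∧
    ∀ x ∈ X, ∀ y ∈ X, ∀ z ∈ X, ¬ ScrTriple x y z := by
  refine ⟨DistScrambled.subshift, DistScrambled.isCompact_subshift,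
    fun x hx => DistScrambled.shift_mem_subshift hx,
    DistScrambled.pt '' DistScrambled.selectors, ?_, ?_, ?_,
    fun x hx y hy z hz => DistScrambled.not_scrTriple hx hy hz⟩
  · rintro _ ⟨e, he, rfl⟩
    exact Or.inr ⟨0, e, he, rfl⟩
  · refine Set.Infinite.image DistScrambled.pt_injective.injOn ?_
    exact (Set.infinite_range_of_injective DistScrambled.selector_injective).mono
      (Set.range_subset_iff.2 DistScrambled.selector_mem)
  · rintro _ ⟨e, he, rfl⟩ _ ⟨e', he', rfl⟩ hne
    have hne' : e ≠ e' := fun h => hne (by rw [h])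
    refine ⟨fun ε hε => DistScrambled.phiStar_eq_one ?_ hε, fun δ _ hδ =>
      DistScrambled.phi_eq_zero ?_ (hδ.trans_le (DistScrambled.diam2_le_one _))⟩
    · refine (DistScrambled.frequently_eq he he').mono fun r hr n h1 h2 => ?_
      rwa [DistScrambled.pt_eq_pt_iff, DistScrambled.blockIdx_eq h1 h2]
    · refine (DistScrambled.frequently_ne he he' hne').mono fun r hr n h1 h2 => ?_
      rwa [Ne, DistScrambled.pt_eq_pt_iff, DistScrambled.blockIdx_eq h1 h2]
end

section
/- Every point y of the Morse minimal set M cannot be a member of a scrambled triple with two points x^i, x^j of the set D from Theorem 1: for such y either the pair (x, y) is distal, in which case (x^i, x^j, y) is not proximal (fails condition (1)), or (x, y) is asymptotic, in which case (x^i, x^j, y) is not scrambled because (x^i, x^j, x) is not scrambled; here x = lim_i x^i ∈ M. -/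
open Filter

open Classical in
/-- The point x^i of Theorem 1: block j+1 is complemented iff j+1 ∈ W_i = {2^n(2i-1) : n ≥ 1}. -/
noncomputable def thm1pt (a : ℕ → ℕ) (i : ℕ) : ℕ → Bool :=
  blockPt a (fun j => if ∃ n ≥ 1, j + 1 = 2 ^ n * (2 * i - 1) then true else false)

lemma length_morseBlock (n : ℕ) : (morseBlock n).length = 2 ^ n := by
  induction n with
  | zero => simp [morseBlock]
  | succ n ih => simp [morseBlock, wordCompl, ih]; ring

lemma getD_wordCompl (B : List Bool) (k : ℕ) (hk : k < B.length) :
    (wordCompl B).getD k false = !(B.getD k false) := by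
  simp [wordCompl, List.getD_eq_getElem?_getD, hk]

lemma getD_morseBlock_of_le {n m k : ℕ} (hnm : n ≤ m) (hk : k < 2 ^ n) :
    (morseBlock m).getD k false = (morseBlock n).getD k false := by
  induction m, hnm using Nat.le_induction with
  | base => rfl
  | succ m hm ih =>
    rw [← ih, morseBlock, List.getD_append]
    rw [length_morseBlock]
    exact hk.trans_le (Nat.pow_le_pow_right (by norm_num) hm)

lemma getD_morseBlock {n k : ℕ} (hk : k < 2 ^ n) :
    (morseBlock n).getD k false = morse k := by
  have hk' : k < 2 ^ (k + 1) := k.lt_succ_self.trans Nat.lt_two_pow_self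
  rcases le_total n (k + 1) with h | h
  · exact (getD_morseBlock_of_le h hk).symm
  · exact getD_morseBlock_of_le h hk'

lemma morse_two_pow_add {n k : ℕ} (hk : k < 2 ^ n) : morse (2 ^ n + k) = !(morse k) := by
  have h : 2 ^ n + k < 2 ^ (n + 1) := by rw [pow_succ]; omega
  rw [← getD_morseBlock h, ← getD_morseBlock hk, morseBlock, List.getD_append_right,
    length_morseBlock, Nat.add_sub_cancel_left, getD_wordCompl]
  · rwa [length_morseBlock]
  · rw [length_morseBlock]; omega

lemma morse_zero : morse 0 = false := by
  simp [morse, morseBlock]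

lemma morse_double_aux (k : ℕ) : morse (2 * k) = morse k ∧ morse (2 * k + 1) = !(morse k) := by
  induction k using Nat.strong_induction_on with
  | _ k ih =>
    rcases Nat.eq_zero_or_pos k with rfl | hk
    · have := morse_two_pow_add (n := 0) (k := 0) (by norm_num)
      simpa using this
    · have h1 : 2 ^ Nat.log 2 k ≤ k := Nat.pow_log_le_self 2 hk.ne'
      have h2 : k < 2 ^ (Nat.log 2 k + 1) := Nat.lt_pow_succ_log_self (by norm_num) k
      generalize Nat.log 2 k = n at h1 h2
      obtain ⟨l, rfl⟩ := Nat.exists_eq_add_of_le h1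
      have hp : 2 ^ (n + 1) = 2 * 2 ^ n := by ring
      have hl : l < 2 ^ n := by omega
      obtain ⟨e, o⟩ := ih l (by have := Nat.two_pow_pos n; omega)
      constructor
      · rw [show 2 * (2 ^ n + l) = 2 ^ (n + 1) + 2 * l by ring,
          morse_two_pow_add (by omega), e, morse_two_pow_add hl]
      · rw [show 2 * (2 ^ n + l) + 1 = 2 ^ (n + 1) + (2 * l + 1) by ring,
          morse_two_pow_add (by omega), o, morse_two_pow_add hl]

lemma morse_double (k : ℕ) : morse (2 * k) = morse k := (morse_double_aux k).1

lemma morse_double_add_one (k : ℕ) : morse (2 * k + 1) = !(morse k) := (morse_double_aux k).2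

lemma morse_two_pow_mul_add {n r : ℕ} (m : ℕ) (hr : r < 2 ^ n) :
    morse (2 ^ n * m + r) = (morse m ^^ morse r) := by
  induction n generalizing r with
  | zero =>
    obtain rfl : r = 0 := by simpa using hr
    simp [morse_zero]
  | succ n ih =>
    rw [pow_succ] at hr
    rcases Nat.even_or_odd' r with ⟨s, rfl | rfl⟩
    · rw [show 2 ^ (n + 1) * m + 2 * s = 2 * (2 ^ n * m + s) by ring, morse_double, morse_double,
        ih (by omega)]
    · rw [show 2 ^ (n + 1) * m + (2 * s + 1) = 2 * (2 ^ n * m + s) + 1 by ring,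
        morse_double_add_one, morse_double_add_one, ih (by omega)]
      simp

lemma morse_two_pow_sub_one {d : ℕ} (hd : Even d) : morse (2 ^ d - 1) = false := by
  obtain ⟨c, rfl⟩ := hd
  induction c with
  | zero => simpa using morse_zero
  | succ c ih =>
    have := Nat.two_pow_pos (c + c)
    have h : 2 ^ (c + 1 + (c + 1)) = 4 * 2 ^ (c + c) := by ring
    rw [show 2 ^ (c + 1 + (c + 1)) - 1 = 2 * (2 * (2 ^ (c + c) - 1) + 1) + 1 by omega,
      morse_double_add_one, morse_double_add_one, ih]
    rfl

/-- Three consecutive entries of the Morse sequence are never equal. -/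
lemma morse_not_cube (m : ℕ) : ¬ (morse m = morse (m + 1) ∧ morse (m + 1) = morse (m + 2)) := by
  rintro ⟨h1, h2⟩
  rcases Nat.even_or_odd' m with ⟨s, rfl | rfl⟩
  · rw [morse_double, morse_double_add_one] at h1
    simp at h1
  · rw [show 2 * s + 1 + 1 = 2 * (s + 1) by ring, show 2 * s + 1 + 2 = 2 * (s + 1) + 1 by ring,
      morse_double, morse_double_add_one] at h2
    simp at h2

lemma odd_of_morse_eq_succ {n : ℕ} (h : morse n = morse (n + 1)) : n % 2 = 1 := by
  rcases Nat.even_or_odd' n with ⟨s, rfl | rfl⟩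
  · rw [morse_double, morse_double_add_one] at h
    simp at h
  · omega

lemma exists_morse_eq_succ (p : ℕ) : ∃ k < 4, morse (p + k) = morse (p + k + 1) := by
  have key : ∀ m, morse (2 * m + 1) = morse (2 * m + 2) ∨ morse (2 * m + 3) = morse (2 * m + 4) := by
    intro m
    have h := morse_not_cube m
    rw [morse_double_add_one, show 2 * m + 2 = 2 * (m + 1) by ring, morse_double,
      show 2 * m + 3 = 2 * (m + 1) + 1 by ring, morse_double_add_one,
      show 2 * m + 4 = 2 * (m + 2) by ring, morse_double]
    revert h
    cases morse m <;> cases morse (m + 1) <;> cases morse (m + 2) <;> simp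
  rcases Nat.even_or_odd' p with ⟨m, rfl | rfl⟩
  · rcases key m with h | h
    · exact ⟨1, by norm_num, h⟩
    · exact ⟨3, by norm_num, h⟩
  · rcases key m with h | h
    · exact ⟨0, by norm_num, h⟩
    · exact ⟨2, by norm_num, h⟩

/-- Recognizability: a window of length `5 * 2 ^ r`, up to complement, determines its position
in the Morse sequence modulo `2 ^ r`. -/
lemma morse_recognizable (c : Bool) {r p q : ℕ}
    (h : ∀ k < 5 * 2 ^ r, morse (p + k) = (c ^^ morse (q + k))) : p ≡ q [MOD 2 ^ r] := by
  induction r generalizing p q with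
  | zero => simp [Nat.modEq_one]
  | succ r ih =>
    have hr := Nat.two_pow_pos r
    rw [pow_succ] at h
    have hpar : p % 2 = q % 2 := by
      obtain ⟨k, hk, e⟩ := exists_morse_eq_succ p
      have e' : morse (q + k) = morse (q + k + 1) := by
        have h1 := h k (by omega)
        have h2 := h (k + 1) (by omega)
        rw [← add_assoc, ← e, h1, ← add_assoc] at h2
        simpa using h2
      have := odd_of_morse_eq_succ e
      have := odd_of_morse_eq_succ e'
      omega
    rw [pow_succ, mul_comm]
    rcases Nat.even_or_odd' p with ⟨s, rfl | rfl⟩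
    · obtain ⟨u, rfl⟩ : ∃ u, q = 2 * u := ⟨q / 2, by omega⟩
      refine Nat.ModEq.mul_left' 2 (ih fun k hk => ?_)
      have := h (2 * k) (by omega)
      rwa [← mul_add, ← mul_add, morse_double, morse_double] at this
    · obtain ⟨u, rfl⟩ : ∃ u, q = 2 * u + 1 := ⟨q / 2, by omega⟩
      refine Nat.ModEq.add_right 1 (Nat.ModEq.mul_left' 2 ?_)
      refine Nat.ModEq.add_right_cancel' 1 (ih fun k hk => ?_)
      have := h (2 * k + 1) (by omega)
      rwa [show 2 * s + 1 + (2 * k + 1) = 2 * (s + 1 + k) by ring,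
        show 2 * u + 1 + (2 * k + 1) = 2 * (u + 1 + k) by ring, morse_double, morse_double] at this

lemma shift_iterate_apply (k : ℕ) (u : ℕ → Bool) (n : ℕ) : shift^[k] u n = u (k + n) := by
  induction k generalizing u with
  | zero => simp
  | succ k ih => rw [Function.iterate_succ_apply, ih, shift, add_right_comm]

lemma exists_morse_window {y : ℕ → Bool} (hy : y ∈ morseMinimal) (N : ℕ) :
    ∃ p, ∀ k < N, y k = morse (p + k) := by
  have hopen : IsOpen {z : ℕ → Bool | ∀ k ∈ Set.Iio N, z k = y k} := by
    have : {z : ℕ → Bool | ∀ k ∈ Set.Iio N, z k = y k} = (Set.Iio N).pi fun k => {y k} := by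
      ext z; simp [Set.mem_pi]
    rw [this]
    exact isOpen_set_pi (Set.finite_Iio N) fun _ _ => isOpen_discrete _
  obtain ⟨z, hz, p, rfl⟩ := mem_closure_iff.1 hy _ hopen fun _ _ => rfl
  exact ⟨p, fun k hk => by rw [← hz k hk, shift_iterate_apply]⟩

lemma summable_dist2 (u v : ℕ → Bool) :
    Summable fun i : ℕ => if u i = v i then (0 : ℝ) else (1 / 2) ^ (i + 1) := by
  refine Summable.of_nonneg_of_le (fun i => ?_) (fun i => ?_)
    ((summable_nat_add_iff 1).2 summable_geometric_two)
  · split_ifs <;> positivity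
  · split_ifs
    · positivity
    · exact le_rfl

lemma dist2_nonneg (u v : ℕ → Bool) : 0 ≤ dist2 u v :=
  tsum_nonneg fun i => by split_ifs <;> positivity

lemma dist2_le_of_agree {u v : ℕ → Bool} {L : ℕ} (h : ∀ i < L, u i = v i) :
    dist2 u v ≤ (1 / 2) ^ L := by
  have hs : HasSum (fun i : ℕ => (1 / 2 : ℝ) ^ (L + 1) * (1 / 2) ^ i) ((1 / 2) ^ L) := by
    have e : (1 / 2 : ℝ) ^ (L + 1) * 2 = (1 / 2) ^ L := by ring
    rw [← e]
    exact hasSum_geometric_two.mul_left _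
  rw [dist2, ← (summable_dist2 u v).sum_add_tsum_nat_add L, Finset.sum_eq_zero, zero_add,
    ← hs.tsum_eq]
  · refine Summable.tsum_le_tsum (fun i => ?_) ((summable_nat_add_iff L).2 (summable_dist2 u v))
      hs.summable
    split_ifs
    · positivity
    · exact le_of_eq (by ring)
  · intro i hi
    rw [if_pos (h i (Finset.mem_range.1 hi))]

lemma dist2_le_one (u v : ℕ → Bool) : dist2 u v ≤ 1 := by
  simpa using dist2_le_of_agree (u := u) (v := v) (L := 0) (by simp)

lemma agree_of_dist2_lt {u v : ℕ → Bool} {L : ℕ} (h : dist2 u v < (1 / 2) ^ L) :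
    ∀ i < L, u i = v i := by
  intro i hi
  by_contra hne
  have h1 := (summable_dist2 u v).le_tsum i fun j _ => by split_ifs <;> positivity
  rw [if_neg hne] at h1
  have h2 : (1 / 2 : ℝ) ^ L ≤ (1 / 2) ^ (i + 1) :=
    pow_le_pow_of_le_one (by norm_num) (by norm_num) hi
  exact absurd (h2.trans h1) (not_le.2 h)

/-- The position at which the `n`-th block of a point `blockPt a e` starts. -/
def blockStart (a : ℕ → ℕ) (n : ℕ) : ℕ := ∑ i ∈ Finset.range n, 2 ^ a i

lemma blockStart_succ (a : ℕ → ℕ) (n : ℕ) : blockStart a (n + 1) = blockStart a n + 2 ^ a n :=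
  Finset.sum_range_succ _ _

lemma blockStart_mono (a : ℕ → ℕ) : Monotone (blockStart a) :=
  monotone_nat_of_le_succ fun n => by rw [blockStart_succ]; exact Nat.le_add_right _ _

lemma le_blockStart (a : ℕ → ℕ) (n : ℕ) : n ≤ blockStart a n := by
  induction n with
  | zero => simp
  | succ n ih =>
    have := Nat.two_pow_pos (a n)
    rw [blockStart_succ]
    omega

lemma exists_block (a : ℕ → ℕ) (k : ℕ) : ∃ n, ∃ r < 2 ^ a n, k = blockStart a n + r := by
  have hex : ∃ n, k < blockStart a (n + 1) := ⟨k, le_blockStart a (k + 1)⟩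
  refine ⟨Nat.find hex, k - blockStart a (Nat.find hex), ?_, ?_⟩
  all_goals
    have h := Nat.find_spec hex
    rw [blockStart_succ] at h
    have h' : blockStart a (Nat.find hex) ≤ k := by
      rcases hn : Nat.find hex with _ | n
      · simp [blockStart]
      · exact not_lt.1 (Nat.find_min hex (m := n) (by omega))
    omega

lemma concatSeq_apply (B : ℕ → List Bool) {n r : ℕ} (hr : r < (B n).length) :
    concatSeq B (∑ i ∈ Finset.range n, (B i).length + r) = (B n).getD r false := by
  have hsucc := fun m => Finset.sum_range_succ (fun i => (B i).length) m
  have hmono : Monotone fun m => ∑ i ∈ Finset.range m, (B i).length :=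
    monotone_nat_of_le_succ fun m => by rw [hsucc]; exact Nat.le_add_right _ _
  have hex : ∃ m, ∑ i ∈ Finset.range m, (B i).length ≤ ∑ i ∈ Finset.range n, (B i).length + r ∧
      ∑ i ∈ Finset.range n, (B i).length + r < ∑ i ∈ Finset.range (m + 1), (B i).length :=
    ⟨n, by omega, by rw [hsucc]; omega⟩
  have hm : hex.choose = n := by
    have h := hex.choose_spec
    generalize hex.choose = m at h
    have hn := hsucc n
    rcases lt_trichotomy m n with hlt | heq | hlt
    · have := hmono (show m + 1 ≤ n from hlt)
      simp only at this
      omega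
    · exact heq
    · have := hmono (show n + 1 ≤ m from hlt)
      simp only at this
      omega
  rw [concatSeq, dif_pos hex, hm, Nat.add_sub_cancel_left]

lemma blockPt_apply (a : ℕ → ℕ) (e : ℕ → Bool) {n r : ℕ} (hr : r < 2 ^ a n) :
    blockPt a e (blockStart a n + r) = (e n ^^ morse r) := by
  have hlen : ∀ j, (if e j then wordCompl (morseBlock (a j)) else morseBlock (a j)).length
      = 2 ^ a j := by
    intro j
    split_ifs <;> simp [wordCompl, length_morseBlock]
  have h := concatSeq_apply
    (fun j => if e j then wordCompl (morseBlock (a j)) else morseBlock (a j)) (n := n) (r := r)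
    (by rwa [hlen])
  simp only [hlen] at h
  rw [blockPt, blockStart, h]
  cases e n
  · simpa using getD_morseBlock hr
  · simpa only [if_true, Bool.true_xor, getD_morseBlock hr] using
      getD_wordCompl (morseBlock (a n)) r (by rwa [length_morseBlock])

section BlockPoints

variable {a : ℕ → ℕ}

lemma blockStart_le_two_pow (hmono : StrictMono a) (n : ℕ) : blockStart a n ≤ 2 ^ a n := by
  induction n with
  | zero => simp [blockStart]
  | succ n ih =>
    have h : 2 ^ (a n + 1) ≤ 2 ^ a (n + 1) :=
      Nat.pow_le_pow_right (by norm_num) (hmono n.lt_succ_self)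
    rw [pow_succ] at h
    rw [blockStart_succ]
    omega

/-- The concatenation of uncomplemented blocks occurs, up to complement, in the Morse sequence. -/
lemma blockPt_false_eq_morse (hmono : StrictMono a) (hpar : ∀ n, a n % 2 = (n + 1) % 2) (n : ℕ)
    {k : ℕ} (hk : k < blockStart a (n + 1)) :
    blockPt a (fun _ => false) k = !(morse (2 ^ a n - blockStart a n + k)) := by
  have hlast : ∀ m r, r < 2 ^ a m → blockPt a (fun _ => false) (blockStart a m + r) =
      !(morse (2 ^ a m - blockStart a m + (blockStart a m + r))) := by
    intro m r hr
    have := blockStart_le_two_pow hmono m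
    rw [blockPt_apply a _ hr, ← add_assoc, Nat.sub_add_cancel this, morse_two_pow_add hr]
    simp
  induction n with
  | zero =>
    have := hlast 0 k (by simpa [blockStart] using hk)
    simpa [blockStart] using this
  | succ n ih =>
    rcases lt_or_ge k (blockStart a (n + 1)) with h | h
    · rw [ih h]
      have h0 := blockStart_le_two_pow hmono n
      have h1 := blockStart_succ a n
      have hlt : a n < a (n + 1) := hmono n.lt_succ_self
      obtain ⟨d, hd⟩ := Nat.exists_eq_add_of_le (show a n + 1 ≤ a (n + 1) from hlt)
      have hev : Even d := by
        rw [Nat.even_iff]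
        have := hpar n
        have := hpar (n + 1)
        omega
      have h2 : 2 ^ a (n + 1) = 2 ^ (a n + 1) * (2 ^ d - 1) + 2 * 2 ^ a n := by
        rw [hd, Nat.mul_sub, ← pow_add, mul_one, ← pow_succ', Nat.sub_add_cancel]
        exact Nat.pow_le_pow_right (by norm_num) (by omega)
      have h3 : 2 ^ a (n + 1) - blockStart a (n + 1) + k =
          2 ^ (a n + 1) * (2 ^ d - 1) + (2 ^ a n - blockStart a n + k) := by omega
      rw [h3, morse_two_pow_mul_add _ (by rw [pow_succ]; omega), morse_two_pow_sub_one hev]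
      simp
    · obtain ⟨r, rfl⟩ := Nat.exists_eq_add_of_le h
      rw [blockStart_succ a (n + 1)] at hk
      exact hlast (n + 1) r (by omega)

lemma blockStart_modEq (hmono : StrictMono a) {n m : ℕ} (hnm : n ≤ m) :
    blockStart a m ≡ blockStart a n [MOD 2 ^ a n] := by
  induction m, hnm using Nat.le_induction with
  | base => rfl
  | succ m hm ih =>
    rw [blockStart_succ]
    have : 2 ^ a m ≡ 0 [MOD 2 ^ a n] :=
      (Nat.modEq_zero_iff_dvd).2 (pow_dvd_pow 2 (hmono.monotone hm))
    simpa using ih.add this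

/-- A point of the Morse minimal set that agrees with the uncomplemented block point on
arbitrarily long windows is equal to it. -/
lemma eq_blockPt_false_of_proximal (hmono : StrictMono a) (hpar : ∀ n, a n % 2 = (n + 1) % 2)
    {y : ℕ → Bool} (hy : y ∈ morseMinimal)
    (hprox : ∀ L, ∃ k, ∀ l < L, y (k + l) = blockPt a (fun _ => false) (k + l)) :
    y = blockPt a (fun _ => false) := by
  set x := blockPt a (fun _ => false) with hx
  have hconst : ∀ n, ∃ c, ∀ k < blockStart a n, y k = (c ^^ x k) := by
    intro n
    obtain ⟨k₀, hk₀⟩ := hprox (5 * 2 ^ a n)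
    obtain ⟨m, hnm, hm⟩ : ∃ m, n ≤ m ∧ k₀ + 5 * 2 ^ a n ≤ blockStart a (m + 1) :=
      ⟨n + (k₀ + 5 * 2 ^ a n), by omega, by
        have := le_blockStart a (n + (k₀ + 5 * 2 ^ a n) + 1); omega⟩
    obtain ⟨p, hp⟩ := exists_morse_window hy (blockStart a (m + 1))
    have hxq : ∀ k < blockStart a (m + 1), x k = !(morse (2 ^ a m - blockStart a m + k)) :=
      fun k hk => blockPt_false_eq_morse hmono hpar m hk
    have hm1 := blockStart_le_two_pow hmono m
    have hq : 2 ^ a m - blockStart a m + blockStart a n ≡ 0 [MOD 2 ^ a n] := by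
      have h1 := (blockStart_modEq hmono hnm).symm.add_left (2 ^ a m - blockStart a m)
      rw [Nat.sub_add_cancel hm1] at h1
      exact h1.trans ((Nat.modEq_zero_iff_dvd).2 (pow_dvd_pow 2 (hmono.monotone hnm)))
    generalize 2 ^ a m - blockStart a m = q at hxq hq
    have hpq : p ≡ q [MOD 2 ^ a n] := by
      refine Nat.ModEq.add_right_cancel' k₀ (morse_recognizable true fun k hk => ?_)
      rw [add_assoc, add_assoc, ← hp _ (by omega), hk₀ k hk, hxq _ (by omega)]
      simp
    have hn := blockStart_le_two_pow hmono n
    have hpos := Nat.two_pow_pos (a n)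
    have hdecomp : ∀ s, s + blockStart a n ≡ 0 [MOD 2 ^ a n] → ∃ c, ∀ k < blockStart a n,
        morse (s + k) = (c ^^ morse (2 ^ a n - blockStart a n + k)) := by
      intro s hs
      obtain ⟨t, ht⟩ := (Nat.modEq_zero_iff_dvd).1 hs
      rcases t with _ | t
      · exact ⟨false, fun k hk => by simp at ht; omega⟩
      · refine ⟨morse t, fun k hk => ?_⟩
        rw [mul_add, mul_one] at ht
        rw [show s + k = 2 ^ a n * t + (2 ^ a n - blockStart a n + k) by omega,
          morse_two_pow_mul_add _ (by omega)]
    obtain ⟨c, hc⟩ := hdecomp p ((hpq.add_right _).trans hq)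
    obtain ⟨c', hc'⟩ := hdecomp q hq
    have hle := blockStart_mono a (show n ≤ m + 1 by omega)
    refine ⟨!(c ^^ c'), fun k hk => ?_⟩
    rw [hp k (by omega), hxq k (by omega), hc k hk, hc' k hk]
    cases c <;> cases c' <;> simp
  obtain ⟨k₀, hk₀⟩ := hprox 1
  have hk₀ := hk₀ 0 one_pos
  funext k
  obtain ⟨c, hc⟩ := hconst (k + k₀ + 1)
  have hle := le_blockStart a (k + k₀ + 1)
  have h1 := hc k (by omega)
  have h2 := hc (k₀ + 0) (by omega)
  rw [hk₀] at h2
  rw [h1]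
  revert h2
  cases c <;> simp

end BlockPoints

/-- The sets `{2 ^ n * (2 * i - 1) : n ≥ 1}`, `i ≥ 1`, are pairwise disjoint. -/
lemma eq_of_two_pow_mul_odd {n m i j : ℕ} (hi : 1 ≤ i) (hj : 1 ≤ j)
    (h : 2 ^ n * (2 * i - 1) = 2 ^ m * (2 * j - 1)) : i = j := by
  wlog hnm : n ≤ m generalizing n m i j
  · exact (this hj hi h.symm (by omega)).symm
  obtain ⟨d, rfl⟩ := Nat.exists_eq_add_of_le hnm
  rw [pow_add, mul_assoc] at h
  have h' := Nat.eq_of_mul_eq_mul_left (Nat.two_pow_pos n) h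
  rcases d with _ | d
  · simp at h'; omega
  · rw [pow_succ', mul_assoc] at h'
    omega

open Classical in
lemma thm1pt_apply (a : ℕ → ℕ) (i : ℕ) {n r : ℕ} (hr : r < 2 ^ a n) :
    thm1pt a i (blockStart a n + r) =
      (decide (∃ m ≥ 1, n + 1 = 2 ^ m * (2 * i - 1)) ^^ blockPt a (fun _ => false)
        (blockStart a n + r)) := by
  rw [thm1pt, blockPt_apply a _ hr, blockPt_apply a _ hr]
  by_cases h : ∃ m ≥ 1, n + 1 = 2 ^ m * (2 * i - 1) <;> simp [h]

lemma thm1pt_eq_of_eq (a : ℕ → ℕ) {i j : ℕ} (hi : 1 ≤ i) (hj : 1 ≤ j) (hij : i ≠ j) {k : ℕ}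
    (h : thm1pt a i k = thm1pt a j k) : thm1pt a i k = blockPt a (fun _ => false) k := by
  obtain ⟨n, r, hr, rfl⟩ := exists_block a k
  rw [thm1pt_apply a i hr, thm1pt_apply a j hr, Bool.xor_left_inj, decide_eq_decide] at h
  rw [thm1pt_apply a i hr]
  by_cases hn : ∃ m ≥ 1, n + 1 = 2 ^ m * (2 * i - 1)
  · obtain ⟨m', -, hm'⟩ := h.1 hn
    obtain ⟨m, -, hm⟩ := hn
    exact absurd (eq_of_two_pow_mul_odd hi hj (hm.symm.trans hm')) hij
  · simp [hn]

lemma thm1pt_eq_or_eq_on_window {a : ℕ → ℕ} (hmono : StrictMono a) {i j : ℕ} (hi : 1 ≤ i)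
    (hj : 1 ≤ j) (hij : i ≠ j) (L : ℕ) {k : ℕ} (hk : blockStart a L ≤ k) :
    (∀ l < L, thm1pt a i (k + l) = blockPt a (fun _ => false) (k + l)) ∨
      ∀ l < L, thm1pt a j (k + l) = blockPt a (fun _ => false) (k + l) := by
  obtain ⟨n, r, hr, rfl⟩ := exists_block a k
  have hn1 := blockStart_succ a n
  have hL : L ≤ n := by
    by_contra! hlt
    have := blockStart_mono a (show n + 1 ≤ L from hlt)
    omega
  have hlen : L ≤ 2 ^ a (n + 1) :=
    hL.trans (n.le_succ.trans ((hmono.id_le (n + 1)).trans Nat.lt_two_pow_self.le))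
  have key : ∀ s, (¬ ∃ m ≥ 1, n + 1 = 2 ^ m * (2 * s - 1)) →
      (¬ ∃ m ≥ 1, n + 1 + 1 = 2 ^ m * (2 * s - 1)) →
      ∀ l < L, thm1pt a s (blockStart a n + r + l) =
        blockPt a (fun _ => false) (blockStart a n + r + l) := by
    intro s h0 h1 l hl
    rcases lt_or_ge (r + l) (2 ^ a n) with h | h
    · rw [add_assoc, thm1pt_apply a s h]
      simp [h0]
    · obtain ⟨t, ht⟩ := Nat.exists_eq_add_of_le h
      rw [show blockStart a n + r + l = blockStart a (n + 1) + t by omega,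
        thm1pt_apply a s (by omega)]
      simp [h1]
  have heven : ∀ {n s : ℕ}, (∃ m ≥ 1, n + 1 = 2 ^ m * (2 * s - 1)) → n % 2 = 1 := by
    rintro n s ⟨m, hm, e⟩
    obtain ⟨m, rfl⟩ := Nat.exists_eq_add_of_le' hm
    rw [pow_succ', mul_assoc] at e
    omega
  have hdisj : ∀ {n : ℕ}, (∃ m ≥ 1, n + 1 = 2 ^ m * (2 * i - 1)) →
      ¬ ∃ m ≥ 1, n + 1 = 2 ^ m * (2 * j - 1) := by
    rintro n ⟨m, -, e⟩ ⟨m', -, e'⟩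
    exact hij (eq_of_two_pow_mul_odd hi hj (e.symm.trans e'))
  by_cases h0 : ∃ m ≥ 1, n + 1 = 2 ^ m * (2 * i - 1)
  · refine Or.inr (key j (hdisj h0) fun h => ?_)
    have := heven h0
    have := heven h
    omega
  · by_cases h1 : ∃ m ≥ 1, n + 1 + 1 = 2 ^ m * (2 * i - 1)
    · refine Or.inr (key j (fun h => ?_) (hdisj h1))
      have := heven h1
      have := heven h
      omega
    · exact Or.inl (key i h0 h1)

/-- A proximal triple agrees simultaneously on arbitrarily long windows. -/
lemma exists_common_window {x y z : ℕ → Bool}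
    (h : liminf (fun k : ℕ => max (max (dist2 (shift^[k] x) (shift^[k] y))
      (dist2 (shift^[k] x) (shift^[k] z))) (dist2 (shift^[k] y) (shift^[k] z))) atTop = 0)
    (L : ℕ) : ∃ k, ∀ l < L, x (k + l) = y (k + l) ∧ x (k + l) = z (k + l) := by
  have hfreq := frequently_lt_of_liminf_lt (b := (1 / 2 : ℝ) ^ L)
    (isBoundedUnder_of ⟨1, fun k => max_le (max_le (dist2_le_one _ _) (dist2_le_one _ _))
      (dist2_le_one _ _)⟩ : IsBoundedUnder (· ≤ ·) atTop _).isCoboundedUnder_ge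
    (h.trans_lt (by positivity))
  obtain ⟨k, hk⟩ := hfreq.exists
  simp only [max_lt_iff] at hk
  refine ⟨k, fun l hl => ⟨?_, ?_⟩⟩
  · simpa only [shift_iterate_apply] using agree_of_dist2_lt hk.1.1 l hl
  · simpa only [shift_iterate_apply] using agree_of_dist2_lt hk.1.2 l hl

/-- If at all large times `z` agrees with `x` or with `y` on a window of any given length, then
`limsup` of the minimal pairwise distance is not positive. -/
lemma limsup_min_dist2_nonpos {x y z : ℕ → Bool}
    (h : ∀ L, ∀ᶠ k in atTop, (∀ l < L, x (k + l) = z (k + l)) ∨ ∀ l < L, y (k + l) = z (k + l)) :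
    limsup (fun k : ℕ => min (min (dist2 (shift^[k] x) (shift^[k] y))
      (dist2 (shift^[k] x) (shift^[k] z))) (dist2 (shift^[k] y) (shift^[k] z))) atTop ≤ 0 := by
  refine ge_of_tendsto' (tendsto_pow_atTop_nhds_zero_of_lt_one (r := (1 / 2 : ℝ)) (by norm_num)
    (by norm_num)) fun L => ?_
  refine limsup_le_of_le ?_ ?_
  · exact (isBoundedUnder_of ⟨0, fun k => le_min (le_min (dist2_nonneg _ _) (dist2_nonneg _ _))
      (dist2_nonneg _ _)⟩ : IsBoundedUnder (· ≥ ·) atTop _).isCoboundedUnder_le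
  · filter_upwards [h L] with k hk
    rcases hk with hk | hk
    · exact (min_le_left _ _).trans ((min_le_right _ _).trans
        (dist2_le_of_agree fun l hl => by simpa only [shift_iterate_apply] using hk l hl))
    · exact (min_le_right _ _).trans
        (dist2_le_of_agree fun l hl => by simpa only [shift_iterate_apply] using hk l hl)

theorem stmt19 (a : ℕ → ℕ) (hmono : StrictMono a) (hpos : ∀ n, 0 < a n)
    (hpar : ∀ n, a n % 2 = (n + 1) % 2)
    (hratio : Tendsto (fun n => (a n : ℝ) / (a (n + 1) : ℝ)) atTop (nhds 0))
    (i j : ℕ) (hi : 1 ≤ i) (hj : 1 ≤ j) (hij : i ≠ j)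
    (y : ℕ → Bool) (hy : y ∈ morseMinimal) :
    ¬ ScrTriple (thm1pt a i) (thm1pt a j) y := by
  rintro ⟨-, -, -, hliminf, hlimsup⟩
  have hyx : y = blockPt a (fun _ => false) := by
    refine eq_blockPt_false_of_proximal hmono hpar hy fun L => ?_
    obtain ⟨k, hk⟩ := exists_common_window hliminf L
    exact ⟨k, fun l hl => (hk l hl).2.symm.trans (thm1pt_eq_of_eq a hi hj hij (hk l hl).1)⟩
  subst hyx
  refine absurd hlimsup (not_lt.2 (limsup_min_dist2_nonpos fun L => ?_))
  filter_upwards [eventually_ge_atTop (blockStart a L)] with k hk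
  exact thm1pt_eq_or_eq_on_window hmono hi hj hij L hk
end
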